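/- Let (Ω, P) be a probability space, let Y be an integrable real-valued random variable, let A : Ω → {0,1} be a random variable with 0 < P(A=1) < 1, and let ε ~ N(0, σ²), σ > 0, be independent of the pair (Y, A). Set Ŷ = Y − ε. For a ∈ {0,1}, let p_a denote the density of Ŷ under the conditional probability measure P(· | A=a) (which is everywhere positive and smooth, being the Gaussian smoothing of the conditional law of Y given A=a). Then for each a ∈ {0,1}: E[(Ŷ + σ²·p_a′(Ŷ)/p_a(Ŷ))·1{A=a}]/P(A=a) = E[Y·1{A=a}]/P(A=a); consequently the stratum-wise Tweedie-corrected difference of group means equals the true difference E[Y | A=1] − E[Y | A=0]. -/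

import Mathlib

open MeasureTheory ProbabilityTheory

/-- The Gaussian-smoothed density of `Ŷ = Y − ε`: `p(ŷ) = ∫ φ_σ(ŷ − y) dμ(y)`,
where `μ` is the law of `Y` and `φ_σ` is the `N(0, σ²)` density. -/
noncomputable def smoothedDensity (μ : Measure ℝ) (σ : ℝ) (t : ℝ) : ℝ :=
  ∫ y, gaussianPDFReal 0 (Real.toNNReal (σ ^ 2)) (t - y) ∂μ

open scoped NNReal ENNReal

lemma tw_sd_eq (μ : Measure ℝ) (σ t : ℝ) : smoothedDensity μ σ t =
    ∫ y, gaussianPDFReal 0 (Real.toNNReal (σ ^ 2)) (t - y) ∂μ := rfl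

lemma tw_shift (v : ℝ≥0) (y t : ℝ) : gaussianPDFReal y v t = gaussianPDFReal 0 v (t - y) := by
  simp [gaussianPDFReal]

lemma tw_hasDeriv (v : ℝ≥0) (x : ℝ) :
    HasDerivAt (gaussianPDFReal 0 v) (-(x / v) * gaussianPDFReal 0 v x) x := by
  have h1 : HasDerivAt (fun x : ℝ => -(x - 0) ^ 2 / (2 * (v:ℝ))) (-(x / v)) x := by
    have := (((hasDerivAt_id' x).sub_const 0).fun_pow 2).fun_neg.div_const (2 * (v:ℝ))
    refine this.congr_deriv ?_
    by_cases hv : (v:ℝ) = 0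
    · simp [hv]
    · simp; field_simp
  have := h1.exp.const_mul ((√(2 * Real.pi * v))⁻¹)
  rw [gaussianPDFReal_def]
  refine this.congr_deriv ?_
  simp only
  ring

lemma tw_bound0 (v : ℝ≥0) (x : ℝ) : ‖gaussianPDFReal 0 v x‖ ≤ (√(2 * Real.pi * v))⁻¹ := by
  rw [Real.norm_of_nonneg (gaussianPDFReal_nonneg _ _ _), gaussianPDFReal]
  apply mul_le_of_le_one_right (by positivity)
  rw [Real.exp_le_one_iff]
  have : 0 ≤ (x - 0)^2 / (2 * (v:ℝ)) := by positivity
  rw [neg_div]; linarith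

lemma tw_bound1 (v : ℝ≥0) (hv : v ≠ 0) (x : ℝ) : ‖-(x / v) * gaussianPDFReal 0 v x‖ ≤
    (1 / v) * ((√(2 * Real.pi * v))⁻¹ * (1 + 2 * v)) := by
  have hv' : (0:ℝ) < v := by positivity
  rw [norm_mul, norm_neg, norm_div, Real.norm_of_nonneg hv'.le,
    Real.norm_of_nonneg (gaussianPDFReal_nonneg _ _ _), gaussianPDFReal, Real.norm_eq_abs]
  have h1 : |x| ≤ 1 + x^2 := by
    rw [← sq_abs x]; nlinarith [sq_nonneg (|x| - 1), abs_nonneg x]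
  set u := x^2 / (2 * (v:ℝ)) with hu
  have hu0 : 0 ≤ u := by positivity
  have hx : x^2 = 2 * v * u := by rw [hu]; field_simp
  have he : -(x - 0)^2 / (2 * (v:ℝ)) = -u := by rw [hu]; ring
  rw [he]
  have h2 : |x| * Real.exp (-u) ≤ 1 + 2 * v := by
    calc |x| * Real.exp (-u) ≤ ((1 + 2 * v) * Real.exp u) * Real.exp (-u) := by
          gcongr
          have := Real.add_one_le_exp u
          nlinarith
      _ = 1 + 2 * v := by rw [mul_assoc, ← Real.exp_add]; simp
  calc |x| / v * ((√(2 * Real.pi * v))⁻¹ * Real.exp (-u))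
      = (1 / v) * ((√(2 * Real.pi * v))⁻¹ * (|x| * Real.exp (-u))) := by ring
    _ ≤ _ := by gcongr

lemma tw_int0 (v : ℝ≥0) (μ : Measure ℝ) [IsFiniteMeasure μ] (t : ℝ) :
    Integrable (fun y => gaussianPDFReal 0 v (t - y)) μ := by
  refine Integrable.of_bound (C := (√(2 * Real.pi * v))⁻¹) ?_ (.of_forall fun y => tw_bound0 v _)
  exact ((measurable_gaussianPDFReal 0 v).comp (by fun_prop)).aestronglyMeasurable

lemma tw_deriv (v : ℝ≥0) (hv : v ≠ 0) (μ : Measure ℝ) [IsFiniteMeasure μ] (t : ℝ) :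
    HasDerivAt (fun t => ∫ y, gaussianPDFReal 0 v (t - y) ∂μ)
      (∫ y, -((t - y) / v) * gaussianPDFReal 0 v (t - y) ∂μ) t := by
  have hm := measurable_gaussianPDFReal 0 v
  refine (hasDerivAt_integral_of_dominated_loc_of_deriv_le (s := Set.univ) Filter.univ_mem
    (F' := fun t y => -((t - y) / v) * gaussianPDFReal 0 v (t - y))
    (bound := fun _ => (1 / v) * ((√(2 * Real.pi * v))⁻¹ * (1 + 2 * v)))
    (.of_forall fun s => (tw_int0 v μ s).aestronglyMeasurable) (tw_int0 v μ t) ?_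
    (.of_forall fun y x _ => tw_bound1 v hv _) (integrable_const _) ?_).2
  · exact (Measurable.mul (by fun_prop) (hm.comp (by fun_prop))).aestronglyMeasurable
  · refine .of_forall fun y x _ => ?_
    simpa using (tw_hasDeriv v (x - y)).comp_sub_const x y

lemma tw_pos (v : ℝ≥0) (hv : v ≠ 0) (μ : Measure ℝ) [IsProbabilityMeasure μ] (t : ℝ) :
    0 < ∫ y, gaussianPDFReal 0 v (t - y) ∂μ := by
  rw [integral_pos_iff_support_of_nonneg (fun y => gaussianPDFReal_nonneg _ _ _) (tw_int0 v μ t)]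
  have : Function.support (fun y => gaussianPDFReal 0 v (t - y)) = Set.univ := by
    ext y; simpa using (gaussianPDFReal_pos 0 v (t - y) hv).ne'
  simp [this]

lemma tw_law (v : ℝ≥0) (hv : v ≠ 0) (μ : Measure ℝ) [IsProbabilityMeasure μ] :
    (μ.prod (gaussianReal 0 v)).map (fun z => z.1 - z.2) =
      volume.withDensity (fun t => ENNReal.ofReal (∫ y, gaussianPDFReal 0 v (t - y) ∂μ)) := by
  have hm := measurable_gaussianPDFReal 0 v
  ext s hs
  rw [Measure.map_apply (by fun_prop) hs, Measure.prod_apply (by measurability),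
    withDensity_apply _ hs]
  have h1 : ∀ y : ℝ, gaussianReal 0 v (Prod.mk y ⁻¹' ((fun z : ℝ × ℝ => z.1 - z.2) ⁻¹' s)) =
      ∫⁻ t in s, ENNReal.ofReal (gaussianPDFReal 0 v (t - y)) := by
    intro y
    have := gaussianReal_map_const_sub (μ := 0) (v := v) y
    rw [sub_zero] at this
    have h2 := congrArg (fun m => m s) this
    change Measure.map _ _ s = _ at h2
    rw [Measure.map_apply (by fun_prop) hs, gaussianReal_apply y hv s] at h2
    simp only [gaussianPDF, tw_shift v y] at h2
    exact h2
  simp_rw [h1]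
  rw [lintegral_lintegral_swap]
  · refine lintegral_congr fun t => ?_
    rw [ofReal_integral_eq_lintegral_ofReal (tw_int0 v μ t)
      (.of_forall fun y => gaussianPDFReal_nonneg _ _ _)]
  · exact (ENNReal.measurable_ofReal.comp (hm.comp
      (measurable_snd.sub measurable_fst))).aemeasurable

lemma tw_int1 (v : ℝ≥0) (hv : v ≠ 0) : Integrable (fun x : ℝ => -(x / v) * gaussianPDFReal 0 v x) := by
  have hv' : (0:ℝ) < v := by positivity
  have := (integrable_mul_exp_neg_mul_sq (b := 1 / (2 * (v:ℝ))) (by positivity)).const_mul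
    (-(1 / v) * (√(2 * Real.pi * v))⁻¹)
  refine this.congr (.of_forall fun x => ?_)
  simp only [gaussianPDFReal]
  have : -(1 / (2 * (v:ℝ))) * x ^ 2 = -(x - 0)^2 / (2 * v) := by ring
  rw [this]; ring

lemma tw_zero (v : ℝ≥0) (hv : v ≠ 0) : ∫ x : ℝ, -(x / v) * gaussianPDFReal 0 v x = 0 := by
  have h := integral_gaussianReal_eq_integral_smul (μ := 0) hv (f := fun x => x)
  rw [integral_id_gaussianReal] at h
  have h2 : ∀ x : ℝ, -(x / v) * gaussianPDFReal 0 v x = -(1/v) * (gaussianPDFReal 0 v x • x) := by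
    intro x; simp; ring
  simp_rw [h2]
  rw [integral_const_mul, ← h, mul_zero]

lemma tw_prodint (v : ℝ≥0) (hv : v ≠ 0) (μ : Measure ℝ) [IsProbabilityMeasure μ] :
    Integrable (fun z : ℝ × ℝ => -((z.1 - z.2) / v) * gaussianPDFReal 0 v (z.1 - z.2))
      (volume.prod μ) := by
  have hm := measurable_gaussianPDFReal 0 v
  rw [integrable_prod_iff']
  · refine ⟨.of_forall fun y => (tw_int1 v hv).comp_sub_right y, ?_⟩
    have : ∀ y : ℝ, ∫ x, ‖-((x - y) / v) * gaussianPDFReal 0 v (x - y)‖ =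
        ∫ x, ‖-(x / v) * gaussianPDFReal 0 v x‖ := fun y =>
      integral_sub_right_eq_self (fun x : ℝ => ‖-(x / v) * gaussianPDFReal 0 v x‖) y
    simp only [this]
    exact integrable_const _
  · exact (Measurable.mul (by fun_prop) (hm.comp (by fun_prop))).aestronglyMeasurable

lemma tw_score (v : ℝ≥0) (hv : v ≠ 0) (μ : Measure ℝ) [IsProbabilityMeasure μ] :
    Integrable (deriv (fun t => ∫ y, gaussianPDFReal 0 v (t - y) ∂μ)) ∧
    ∫ t, deriv (fun t => ∫ y, gaussianPDFReal 0 v (t - y) ∂μ) t = 0 := by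
  have h : deriv (fun t => ∫ y, gaussianPDFReal 0 v (t - y) ∂μ) =
      fun t => ∫ y, -((t - y) / v) * gaussianPDFReal 0 v (t - y) ∂μ :=
    funext fun t => (tw_deriv v hv μ t).deriv
  rw [h]
  have hp := tw_prodint v hv μ
  refine ⟨hp.integral_prod_left, ?_⟩
  rw [integral_integral_swap hp]
  have : ∀ y : ℝ, ∫ x, -((x - y) / v) * gaussianPDFReal 0 v (x - y) = 0 := fun y =>
    (integral_sub_right_eq_self (fun x : ℝ => -(x / v) * gaussianPDFReal 0 v x) y).trans
      (tw_zero v hv)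
  simp only [this, integral_zero]

lemma tw_core (v : ℝ≥0) (hv : v ≠ 0) (μ : Measure ℝ) [IsProbabilityMeasure μ]
    (p : ℝ → ℝ) (hp : p = fun t => ∫ y, gaussianPDFReal 0 v (t - y) ∂μ) :
    Integrable (fun z : ℝ × ℝ => v * deriv p (z.1 - z.2) / p (z.1 - z.2))
      (μ.prod (gaussianReal 0 v)) ∧
    ∫ z : ℝ × ℝ, v * deriv p (z.1 - z.2) / p (z.1 - z.2) ∂(μ.prod (gaussianReal 0 v)) = 0 := by
  have hpos : ∀ t, 0 < p t := fun t => by rw [hp]; exact tw_pos v hv μ t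
  have hpc : Measurable p := by
    have : Differentiable ℝ p := fun t => by
      rw [hp]; exact (tw_deriv v hv μ t).differentiableAt
    exact this.continuous.measurable
  have hlaw := tw_law v hv μ
  have hsc := tw_score v hv μ
  rw [← hp] at hsc
  have hp' : (fun t => ENNReal.ofReal (∫ y, gaussianPDFReal 0 v (t - y) ∂μ)) =
      fun t => ENNReal.ofReal (p t) := by rw [hp]
  rw [hp'] at hlaw
  have hg : Measurable (fun t => v * deriv p t / p t) :=
    ((measurable_deriv p).const_mul _).div hpc
  have heq : (fun t => (ENNReal.ofReal (p t)).toReal • (v * deriv p t / p t)) =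
      fun t => v * deriv p t := by
    funext t
    rw [ENNReal.toReal_ofReal (hpos t).le, smul_eq_mul]
    have := (hpos t).ne'
    field_simp
  have hsub : Measurable (fun z : ℝ × ℝ => z.1 - z.2) := by fun_prop
  constructor
  · have : Integrable (fun t => v * deriv p t / p t)
        ((μ.prod (gaussianReal 0 v)).map (fun z => z.1 - z.2)) := by
      rw [hlaw, integrable_withDensity_iff_integrable_smul' (by fun_prop) (by simp), heq]
      exact hsc.1.const_mul _
    exact this.comp_measurable hsub
  · rw [← integral_map (f := fun t => v * deriv p t / p t) hsub.aemeasurable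
      hg.aestronglyMeasurable, hlaw,
      integral_withDensity_eq_integral_toReal_smul (by fun_prop) (by simp), heq,
      integral_const_mul, hsc.2, mul_zero]

lemma tw_joint {Ω : Type*} [MeasurableSpace Ω] (P : Measure Ω) [IsProbabilityMeasure P]
    (Y ε A : Ω → ℝ) (hY : Measurable Y) (hε : Measurable ε) (hA : Measurable A)
    (hindep : IndepFun (fun ω => (Y ω, A ω)) ε P) (a : ℝ) (ha : P {ω | A ω = a} ≠ 0) :
    (P[|{ω | A ω = a}]).map (fun ω => (Y ω, ε ω)) =
      ((P[|{ω | A ω = a}]).map Y).prod (P.map ε) := by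
  have hS : MeasurableSet {ω | A ω = a} := hA (measurableSet_singleton a)
  have := cond_isProbabilityMeasure ha
  have := Measure.isProbabilityMeasure_map (μ := P[|{ω | A ω = a}]) hY.aemeasurable
  have := Measure.isProbabilityMeasure_map (μ := P) hε.aemeasurable
  symm
  refine Measure.prod_eq fun s t hs ht => ?_
  rw [Measure.map_apply (hY.prodMk hε) (hs.prod ht), Measure.map_apply hY hs,
    Measure.map_apply hε ht, cond_apply hS, cond_apply hS, mul_assoc]
  congr 1
  have := hindep.measure_inter_preimage_eq_mul (s ×ˢ {a}) t
    (hs.prod (measurableSet_singleton a)) ht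
  convert this using 2
  · ext ω; simp; tauto
  · congr 1; ext ω; simp; tauto

lemma tw_group {Ω : Type*} [MeasurableSpace Ω] (P : Measure Ω) [IsProbabilityMeasure P]
    (Y ε A : Ω → ℝ) (σ : ℝ) (hσ : 0 < σ) (hYint : Integrable Y P)
    (hY : Measurable Y) (hε : Measurable ε) (hA : Measurable A)
    (hindep : IndepFun (fun ω => (Y ω, A ω)) ε P)
    (hεlaw : P.map ε = gaussianReal 0 (Real.toNNReal (σ ^ 2)))
    (a : ℝ) (ha : P {ω | A ω = a} ≠ 0) :
    ∫ ω in {ω | A ω = a},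
          ((Y ω - ε ω)
            + σ ^ 2 * deriv (smoothedDensity ((P[|{ω | A ω = a}]).map Y) σ) (Y ω - ε ω)
                / smoothedDensity ((P[|{ω | A ω = a}]).map Y) σ (Y ω - ε ω)) ∂P
      = ∫ ω in {ω | A ω = a}, Y ω ∂P := by
  have hj := tw_joint P Y ε A hY hε hA hindep a ha
  have := cond_isProbabilityMeasure ha
  have := Measure.isProbabilityMeasure_map (μ := P[|{ω | A ω = a}]) hY.aemeasurable
  set Q := P[|{ω | A ω = a}] with hQ
  have hv : Real.toNNReal (σ ^ 2) ≠ 0 := by simp; positivity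
  have hvσ : ((Real.toNNReal (σ ^ 2) : ℝ≥0) : ℝ) = σ ^ 2 := Real.coe_toNNReal _ (by positivity)
  obtain ⟨hi, hz⟩ := tw_core _ hv (Q.map Y) (smoothedDensity (Q.map Y) σ) rfl
  rw [hvσ] at hi hz
  rw [hεlaw] at hj
  rw [← hj] at hi hz
  have hYε : Measurable (fun ω => (Y ω, ε ω)) := hY.prodMk hε
  rw [integral_map hYε.aemeasurable hi.aestronglyMeasurable] at hz
  have hi' := hi.comp_measurable hYε
  have hr : P.restrict {ω | A ω = a} = P {ω | A ω = a} • Q := by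
    rw [hQ, ProbabilityTheory.cond, smul_smul, ENNReal.mul_inv_cancel ha (measure_ne_top _ _),
      one_smul]
  have hYQ : Integrable Y Q := by
    rw [hQ, ProbabilityTheory.cond]
    exact hYint.restrict.smul_measure (ENNReal.inv_ne_top.2 ha)
  have hεQlaw : Q.map ε = gaussianReal 0 (Real.toNNReal (σ ^ 2)) := by
    have := congrArg (fun m => m.map Prod.snd) hj
    rw [Measure.map_map measurable_snd hYε] at this
    simpa [Measure.map_snd_prod, Function.comp_def] using this
  have hid : Integrable (fun x : ℝ => x) (gaussianReal 0 (Real.toNNReal (σ ^ 2))) :=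
    (memLp_id_gaussianReal 1).integrable (by simp)
  have hεQ : Integrable ε Q := by
    rw [← hεQlaw] at hid
    exact hid.comp_measurable hε
  have hε0 : ∫ ω, ε ω ∂Q = 0 := by
    have := integral_map (μ := Q) hε.aemeasurable (f := fun x : ℝ => x)
      measurable_id.aestronglyMeasurable
    rw [← this, hεQlaw, integral_id_gaussianReal]
  rw [hr, integral_smul_measure, integral_smul_measure]
  congr 1
  refine (integral_add (hYQ.sub hεQ) hi').trans ?_
  refine (congrArg₂ (· + ·) (integral_sub hYQ hεQ) hz).trans ?_
  rw [hε0]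
  simp

/-- **Stratum-wise Tweedie correction recovers group means (causal debiasing).**
For `Ŷ = Y − ε` with `ε ~ N(0, σ²)` independent of `(Y, A)`, the Tweedie correction
computed with the stratum density `p_a` (the density of `Ŷ` under `P(·|A=a)`)
recovers each group mean `E[Y | A=a]`, and hence the corrected difference of group
means equals the true difference `E[Y | A=1] − E[Y | A=0]`. -/
theorem tweedie_correction_group_means
    {Ω : Type*} [MeasurableSpace Ω] (P : Measure Ω) [IsProbabilityMeasure P]
    (Y ε A : Ω → ℝ) (σ : ℝ) (hσ : 0 < σ)
    (hYint : Integrable Y P)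
    (hY : Measurable Y) (hε : Measurable ε)
    (hAmeas : Measurable A) (hA01 : ∀ ω, A ω = 0 ∨ A ω = 1)
    (hA1pos : 0 < P {ω | A ω = 1}) (hA1lt : P {ω | A ω = 1} < 1)
    (hindep : IndepFun (fun ω => (Y ω, A ω)) ε P)
    (hεlaw : P.map ε = gaussianReal 0 (Real.toNNReal (σ ^ 2))) :
    (∀ a ∈ ({0, 1} : Set ℝ),
      (∫ ω in {ω | A ω = a},
          ((Y ω - ε ω)
            + σ ^ 2 * deriv (smoothedDensity ((P[|{ω | A ω = a}]).map Y) σ) (Y ω - ε ω)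
                / smoothedDensity ((P[|{ω | A ω = a}]).map Y) σ (Y ω - ε ω)) ∂P)
          / (P {ω | A ω = a}).toReal
        = (∫ ω in {ω | A ω = a}, Y ω ∂P) / (P {ω | A ω = a}).toReal)
    ∧ (∫ ω in {ω | A ω = 1},
          ((Y ω - ε ω)
            + σ ^ 2 * deriv (smoothedDensity ((P[|{ω | A ω = 1}]).map Y) σ) (Y ω - ε ω)
                / smoothedDensity ((P[|{ω | A ω = 1}]).map Y) σ (Y ω - ε ω)) ∂P)
          / (P {ω | A ω = 1}).toReal
        - (∫ ω in {ω | A ω = 0},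
          ((Y ω - ε ω)
            + σ ^ 2 * deriv (smoothedDensity ((P[|{ω | A ω = 0}]).map Y) σ) (Y ω - ε ω)
                / smoothedDensity ((P[|{ω | A ω = 0}]).map Y) σ (Y ω - ε ω)) ∂P)
          / (P {ω | A ω = 0}).toReal
      = (∫ ω in {ω | A ω = 1}, Y ω ∂P) / (P {ω | A ω = 1}).toReal
        - (∫ ω in {ω | A ω = 0}, Y ω ∂P) / (P {ω | A ω = 0}).toReal := by
  have h1 : P {ω | A ω = 1} ≠ 0 := hA1pos.ne'
  have h0 : P {ω | A ω = 0} ≠ 0 := by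
    intro h
    have hc : {ω | A ω = 1} = {ω | A ω = 0}ᶜ := by
      ext ω
      rcases hA01 ω with h | h <;> simp [h]
    have hS : MeasurableSet {ω | A ω = 0} := hAmeas (measurableSet_singleton 0)
    rw [hc, (prob_compl_eq_one_iff hS).2 h] at hA1lt
    exact lt_irrefl _ hA1lt
  have key := tw_group P Y ε A σ hσ hYint hY hε hAmeas hindep hεlaw
  refine ⟨?_, ?_⟩
  · intro a ha
    rcases ha with rfl | ha
    · rw [key _ h0]
    · rw [Set.mem_singleton_iff] at ha
      subst ha
      rw [key _ h1]
  · rw [key _ h0, key _ h1]
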